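/- arXiv:2512.23238 — 2 statements merged into one kernel-verified Lean document; each statement's English description precedes it below -/
import Mathlib

section
/- Let m ≥ 1 be an integer, let i be an integer with 1 ≤ i ≤ m, and let p be a univariate real polynomial of degree at most m − i. Then the pair of bivariate polynomials (q⁻, q⁺) defined by q⁻(η,ξ) = (1/β⁻)·ηⁱ·p(ξ) and q⁺(η,ξ) = (1/β⁺)·ηⁱ·p(ξ) satisfies the Frenet interface jump conditions (i)–(iii), for every choice of smooth coefficient functions J₀, J₁, J₂ in the operator 𝓛. -/
open MvPolynomial

/-- Evaluation of a bivariate polynomial at `(η, ξ)`. -/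
noncomputable def evalP (q : MvPolynomial (Fin 2) ℝ) (η ξ : ℝ) : ℝ :=
  MvPolynomial.eval ![η, ξ] q

/-- The second-order operator `𝓛 u = u_ηη + J₀ u_ξξ + J₁ u_η + J₂ u_ξ`
(the Laplacian expressed in Frenet coordinates). -/
noncomputable def Lop (J₀ J₁ J₂ : ℝ → ℝ → ℝ) (u : ℝ → ℝ → ℝ) (η ξ : ℝ) : ℝ :=
  iteratedDeriv 2 (fun t => u t ξ) η
    + J₀ η ξ * iteratedDeriv 2 (fun s => u η s) ξ
    + J₁ η ξ * deriv (fun t => u t ξ) η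
    + J₂ η ξ * deriv (fun s => u η s) ξ

/-- The Frenet interface jump conditions (i)–(iii) for a pair `(qm, qp)` of
bivariate polynomials. -/
def JumpConds (m : ℕ) (ξ₀ ξ₁ βm βp : ℝ) (J₀ J₁ J₂ : ℝ → ℝ → ℝ)
    (qm qp : MvPolynomial (Fin 2) ℝ) : Prop :=
  (∀ ξ ∈ Set.Icc ξ₀ ξ₁, evalP qp 0 ξ = evalP qm 0 ξ) ∧
  (∀ ξ ∈ Set.Icc ξ₀ ξ₁,
    βp * deriv (fun t => evalP qp t ξ) 0 = βm * deriv (fun t => evalP qm t ξ) 0) ∧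
  (∀ n : ℕ, n + 2 ≤ m → ∀ v : Polynomial ℝ, v.natDegree ≤ m - 2 - n →
    ∫ ξ in ξ₀..ξ₁, v.eval ξ *
      (βp * iteratedDeriv n (fun t => Lop J₀ J₁ J₂ (evalP qp) t ξ) 0
        - βm * iteratedDeriv n (fun t => Lop J₀ J₁ J₂ (evalP qm) t ξ) 0) = 0)

lemma evalP_C_mul_X_pow_mul_aeval (c : ℝ) (i : ℕ) (p : Polynomial ℝ) :
    evalP (C c * X 0 ^ i * Polynomial.aeval (X 1) p) =
      fun η ξ => c * (η ^ i * p.eval ξ) := by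
  funext η ξ
  have h : MvPolynomial.eval ![η, ξ] (Polynomial.aeval (X 1) p) = p.eval ξ := by
    rw [← MvPolynomial.coe_aeval_eq_eval, RingHom.coe_coe, ← Polynomial.aeval_algHom_apply]
    simp
  simp [evalP, h, mul_assoc]

lemma Lop_const_mul (J₀ J₁ J₂ : ℝ → ℝ → ℝ) (c : ℝ) (u : ℝ → ℝ → ℝ) (η ξ : ℝ) :
    Lop J₀ J₁ J₂ (fun η ξ => c * u η ξ) η ξ = c * Lop J₀ J₁ J₂ u η ξ := by
  simp only [Lop, iteratedDeriv_const_mul_field, deriv_const_mul_field]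
  ring

/-- The pair `((1/β⁻)·ηⁱ·p(ξ), (1/β⁺)·ηⁱ·p(ξ))`, with `1 ≤ i ≤ m` and
`deg p ≤ m - i`, satisfies the Frenet interface jump conditions for any choice of
smooth coefficients `J₀, J₁, J₂`. -/
theorem stmt_0 (m i : ℕ) (hm : 1 ≤ m) (hi1 : 1 ≤ i) (him : i ≤ m)
    (ξ₀ ξ₁ : ℝ) (hξ : ξ₀ < ξ₁) (βm βp : ℝ) (hβm : 0 < βm) (hβp : 0 < βp)
    (p : Polynomial ℝ) (hp : p.natDegree ≤ m - i)
    (J₀ J₁ J₂ : ℝ → ℝ → ℝ)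
    (hJ₀ : ContDiff ℝ (⊤ : ℕ∞) (Function.uncurry J₀))
    (hJ₁ : ContDiff ℝ (⊤ : ℕ∞) (Function.uncurry J₁))
    (hJ₂ : ContDiff ℝ (⊤ : ℕ∞) (Function.uncurry J₂)) :
    JumpConds m ξ₀ ξ₁ βm βp J₀ J₁ J₂
      (C βm⁻¹ * X 0 ^ i * Polynomial.aeval (X 1) p)
      (C βp⁻¹ * X 0 ^ i * Polynomial.aeval (X 1) p) := by
  have hm0 := hβm.ne'
  have hp0 := hβp.ne'
  simp only [JumpConds, evalP_C_mul_X_pow_mul_aeval, Lop_const_mul,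
    iteratedDeriv_const_mul_field, deriv_const_mul_field]
  refine ⟨fun ξ _ => ?_, fun ξ _ => ?_, fun n _ v _ => ?_⟩
  · simp [zero_pow (Nat.one_le_iff_ne_zero.mp hi1)]
  · rw [mul_inv_cancel_left₀ hm0, mul_inv_cancel_left₀ hp0]
  · simp [mul_inv_cancel_left₀ hm0, mul_inv_cancel_left₀ hp0]
end

section
/- Let m ≥ 1 be an integer, let ξ₀ < ξ₁ be reals, let β⁻, β⁺ > 0, and let J₀, J₁, J₂ : ℝ² → ℝ be smooth, with 𝓛 the associated operator. Then for every real polynomial q⁻ in (η,ξ) of total degree at most m there exists a unique real polynomial q⁺ in (η,ξ) of total degree at most m such that the pair (q⁻, q⁺) satisfies the Frenet interface jump conditions (i)–(iii). -/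
open MvPolynomial

/-- Bivariate polynomials in `(η, ξ)` as polynomials in `η` over `ℝ[ξ]`. -/
noncomputable def toPolyPoly : MvPolynomial (Fin 2) ℝ ≃ₐ[ℝ] Polynomial (Polynomial ℝ) :=
  AlgEquiv.ofAlgHom
    (aeval ![Polynomial.X, Polynomial.C Polynomial.X])
    (Polynomial.eval₂AlgHom (Polynomial.aeval (X 1)) (X 0) fun _ => Commute.all _ _)
    (by ext <;> simp)
    (by ext i; fin_cases i <;> simp)

lemma toPolyPoly_X_zero : toPolyPoly (X 0) = Polynomial.X := by
  simp [toPolyPoly]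

/-- The coefficient of `η ^ k`, a polynomial in `ξ`. -/
noncomputable def etaCoeff (k : ℕ) : MvPolynomial (Fin 2) ℝ →ₗ[ℝ] Polynomial ℝ :=
  (Polynomial.lcoeff (Polynomial ℝ) k).restrictScalars ℝ ∘ₗ toPolyPoly.toLinearMap

lemma etaCoeff_apply (k : ℕ) (q : MvPolynomial (Fin 2) ℝ) :
    etaCoeff k q = (toPolyPoly q).coeff k := rfl

lemma etaCoeff_coeff (k j : ℕ) (q : MvPolynomial (Fin 2) ℝ) :
    (etaCoeff k q).coeff j = q.coeff (Finsupp.single 0 k + Finsupp.single 1 j) := by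
  suffices h : Polynomial.lcoeff ℝ j ∘ₗ etaCoeff k =
      MvPolynomial.lcoeff ℝ (Finsupp.single 0 k + Finsupp.single 1 j) from
    LinearMap.congr_fun h q
  refine MvPolynomial.linearMap_ext fun s => LinearMap.ext_ring ?_
  have hs : s = Finsupp.single 0 k + Finsupp.single 1 j ↔ k = s 0 ∧ j = s 1 := by
    rw [Finsupp.ext_iff, Fin.forall_fin_two]
    simp [eq_comm]
  have hm : toPolyPoly (monomial s 1) =
      Polynomial.X ^ s 0 * Polynomial.C (Polynomial.X ^ s 1) := by
    simp [toPolyPoly, aeval_monomial, Finsupp.prod_fintype]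
  simp only [LinearMap.comp_apply, Polynomial.lcoeff_apply, etaCoeff_apply, hm,
    Polynomial.coeff_mul_C, Polynomial.coeff_X_pow, MvPolynomial.lcoeff_apply, coeff_monomial, hs]
  by_cases hk : k = s 0 <;> simp [hk, Polynomial.coeff_X_pow]

lemma totalDegree_le_iff_natDegree_etaCoeff {m : ℕ} {q : MvPolynomial (Fin 2) ℝ} :
    q.totalDegree ≤ m ↔
      ∀ k, (etaCoeff k q).natDegree ≤ m - k ∧ (m < k → etaCoeff k q = 0) := by
  have deg (s : Fin 2 →₀ ℕ) : s = Finsupp.single 0 (s 0) + Finsupp.single 1 (s 1) := by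
    rw [Finsupp.ext_iff, Fin.forall_fin_two]
    simp
  have hzero (h : q.totalDegree ≤ m) (k j : ℕ) (hkj : m < k + j) : (etaCoeff k q).coeff j = 0 := by
    rw [etaCoeff_coeff]
    refine coeff_eq_zero_of_totalDegree_lt (h.trans_lt ?_)
    rw [← Finsupp.degree_apply]
    simpa using hkj
  constructor
  · intro h k
    exact ⟨Polynomial.natDegree_le_iff_coeff_eq_zero.2 fun j hj => hzero h k j (by omega),
      fun hk => Polynomial.ext fun j => by simpa using hzero h k j (by omega)⟩
  · intro h
    refine Finset.sup_le fun s hs => ?_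
    by_contra! hlt
    have hsum : m < s 0 + s 1 := by simpa [Finsupp.sum_fintype] using hlt
    refine mem_support_iff.1 hs ?_
    rw [deg s, ← etaCoeff_coeff]
    obtain ⟨hdeg, hlarge⟩ := h (s 0)
    rcases lt_or_ge m (s 0) with hk | hk
    · simp [hlarge hk]
    · exact Polynomial.coeff_eq_zero_of_natDegree_lt (by omega)

lemma etaCoeff_symm_monomial (k i : ℕ) (v : Polynomial ℝ) :
    etaCoeff i (toPolyPoly.symm (Polynomial.monomial k v)) = if k = i then v else 0 := by
  simp [etaCoeff_apply, Polynomial.coeff_monomial]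

lemma totalDegree_toPolyPoly_symm_monomial_le {m k : ℕ} (hk : k ≤ m) {v : Polynomial ℝ}
    (hv : v.natDegree ≤ m - k) :
    (toPolyPoly.symm (Polynomial.monomial k v)).totalDegree ≤ m := by
  refine totalDegree_le_iff_natDegree_etaCoeff.2 fun i => ?_
  rw [etaCoeff_symm_monomial]
  split_ifs with h
  · subst h
    exact ⟨hv, fun h => absurd hk h.not_ge⟩
  · simp

lemma eq_zero_of_etaCoeff {q : MvPolynomial (Fin 2) ℝ} (h : ∀ k, etaCoeff k q = 0) : q = 0 :=
  (map_eq_zero_iff toPolyPoly toPolyPoly.injective).1 (Polynomial.ext h)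

lemma X_pow_dvd_of_etaCoeff {q : MvPolynomial (Fin 2) ℝ} {k : ℕ}
    (h : ∀ i < k, etaCoeff i q = 0) : X 0 ^ k ∣ q := by
  rw [← map_dvd_iff toPolyPoly, map_pow, toPolyPoly_X_zero, Polynomial.X_pow_dvd_iff]
  exact h

lemma etaCoeff_X_pow_mul (k : ℕ) (r : MvPolynomial (Fin 2) ℝ) :
    etaCoeff k (X 0 ^ k * r) = etaCoeff 0 r := by
  simp [etaCoeff_apply, toPolyPoly_X_zero, Polynomial.coeff_X_pow_mul']

lemma evalP_eq_eval (q : MvPolynomial (Fin 2) ℝ) (η ξ : ℝ) :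
    evalP q η ξ = ((toPolyPoly q).eval (Polynomial.C η)).eval ξ := by
  suffices h : MvPolynomial.aeval ![η, ξ] =
      ((Polynomial.aeval ξ).comp
        ((Polynomial.aeval (R := Polynomial ℝ) (Polynomial.C η)).restrictScalars ℝ)).comp
          toPolyPoly.toAlgHom by
    simpa [evalP, Polynomial.coe_aeval_eq_eval] using DFunLike.congr_fun h q
  ext i
  fin_cases i <;> simp [toPolyPoly]

lemma evalP_zero_left (q : MvPolynomial (Fin 2) ℝ) (ξ : ℝ) :
    evalP q 0 ξ = (etaCoeff 0 q).eval ξ := by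
  rw [evalP_eq_eval, map_zero, ← Polynomial.coeff_zero_eq_eval_zero, etaCoeff_apply]

lemma hasDerivAt_evalP_left (q : MvPolynomial (Fin 2) ℝ) (η ξ : ℝ) :
    HasDerivAt (fun t => evalP q t ξ) (evalP (pderiv 0 q) η ξ) η := by
  simp only [evalP]
  induction q using MvPolynomial.induction_on with
  | C a => simpa using hasDerivAt_const η a
  | add p q hp hq => simpa using hp.fun_add hq
  | mul_X p i hp =>
    fin_cases i
    · simpa [pderiv_mul, add_comm, mul_comm] using hp.fun_mul (hasDerivAt_id η)
    · simpa [pderiv_mul, add_comm, mul_comm, pderiv_X] using hp.mul_const ξ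

lemma hasDerivAt_evalP_right (q : MvPolynomial (Fin 2) ℝ) (η ξ : ℝ) :
    HasDerivAt (fun s => evalP q η s) (evalP (pderiv 1 q) η ξ) ξ := by
  simp only [evalP]
  induction q using MvPolynomial.induction_on with
  | C a => simpa using hasDerivAt_const ξ a
  | add p q hp hq => simpa using hp.fun_add hq
  | mul_X p i hp =>
    fin_cases i
    · simpa [pderiv_mul, add_comm, mul_comm, pderiv_X] using hp.mul_const η
    · simpa [pderiv_mul, add_comm, mul_comm] using hp.fun_mul (hasDerivAt_id ξ)

lemma contDiff_evalP (q : MvPolynomial (Fin 2) ℝ) {n : WithTop ℕ∞} :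
    ContDiff ℝ n (Function.uncurry (evalP q)) := by
  have h : Function.uncurry (evalP q) =
      fun x : ℝ × ℝ => ∑ d ∈ q.support, q.coeff d * (x.1 ^ d 0 * x.2 ^ d 1) := by
    ext x
    simp [Function.uncurry, evalP, eval_eq', Fin.prod_univ_two]
  rw [h]
  fun_prop

lemma Lop_evalP (J₀ J₁ J₂ : ℝ → ℝ → ℝ) (q : MvPolynomial (Fin 2) ℝ) :
    Lop J₀ J₁ J₂ (evalP q) = fun η ξ =>
      evalP (pderiv 0 (pderiv 0 q)) η ξ + J₀ η ξ * evalP (pderiv 1 (pderiv 1 q)) η ξ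
        + J₁ η ξ * evalP (pderiv 0 q) η ξ + J₂ η ξ * evalP (pderiv 1 q) η ξ := by
  ext η ξ
  have h0 (q) (ξ : ℝ) : deriv (fun t => evalP q t ξ) = fun t => evalP (pderiv 0 q) t ξ :=
    funext fun t => (hasDerivAt_evalP_left q t ξ).deriv
  have h1 (q) (η : ℝ) : deriv (fun s => evalP q η s) = fun s => evalP (pderiv 1 q) η s :=
    funext fun s => (hasDerivAt_evalP_right q η s).deriv
  simp only [Lop, iteratedDeriv_succ, iteratedDeriv_zero, h0, h1]

lemma contDiff_Lop_evalP {J₀ J₁ J₂ : ℝ → ℝ → ℝ} {n : WithTop ℕ∞}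
    (hJ₀ : ContDiff ℝ n (Function.uncurry J₀)) (hJ₁ : ContDiff ℝ n (Function.uncurry J₁))
    (hJ₂ : ContDiff ℝ n (Function.uncurry J₂)) (q : MvPolynomial (Fin 2) ℝ) :
    ContDiff ℝ n (Function.uncurry (Lop J₀ J₁ J₂ (evalP q))) := by
  rw [Lop_evalP]
  exact (((contDiff_evalP _).add (hJ₀.mul (contDiff_evalP _))).add
    (hJ₁.mul (contDiff_evalP _))).add (hJ₂.mul (contDiff_evalP _))

lemma contDiff_slice_left {F : ℝ → ℝ → ℝ} {n : WithTop ℕ∞}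
    (hF : ContDiff ℝ n (Function.uncurry F)) (ξ : ℝ) : ContDiff ℝ n fun t => F t ξ :=
  hF.comp (contDiff_id.prodMk contDiff_const)

lemma contDiff_iteratedDeriv_left {F : ℝ → ℝ → ℝ}
    (hF : ContDiff ℝ (⊤ : ℕ∞) (Function.uncurry F)) (n : ℕ) :
    ContDiff ℝ (⊤ : ℕ∞)
      (Function.uncurry fun η ξ => iteratedDeriv n (fun t => F t ξ) η) := by
  induction n with
  | zero => simpa using hF
  | succ n ih =>
    set G : ℝ → ℝ → ℝ := fun η ξ => iteratedDeriv n (fun t => F t ξ) η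
    have h : (Function.uncurry fun η ξ => iteratedDeriv (n + 1) (fun t => F t ξ) η) =
        fun x => fderiv ℝ (Function.uncurry G) x (1, 0) := by
      ext ⟨η, ξ⟩
      have hG : HasFDerivAt (Function.uncurry G) (fderiv ℝ (Function.uncurry G) (η, ξ)) (η, ξ) :=
        (ih.differentiable (by simp) _).hasFDerivAt
      have := hG.comp_hasDerivAt η ((hasDerivAt_id η).prodMk (hasDerivAt_const η ξ))
      simpa only [iteratedDeriv_succ] using! this.deriv
    rw [h]
    exact (ih.fderiv_right (by simp)).clm_apply contDiff_const

lemma iteratedDeriv_pow_mul_zero {f : ℝ → ℝ} {n : ℕ} (hf : ContDiff ℝ n f) :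
    iteratedDeriv n (fun t => t ^ n * f t) 0 = n.factorial * f 0 := by
  rw [iteratedDeriv_fun_mul (by fun_prop) hf.contDiffAt, Finset.sum_range_succ,
    Finset.sum_eq_zero fun i hi => by
      rw [iteratedDeriv_fun_pow_zero, if_neg (Finset.mem_range.1 hi).ne]; simp]
  simp [Nat.descFactorial_self]

lemma eq_zero_of_integral_eval_sq {a b : ℝ} (hab : a < b) {p : Polynomial ℝ}
    (h : ∫ x in a..b, p.eval x * p.eval x = 0) : p = 0 := by
  refine p.eq_zero_of_infinite_isRoot ((Set.Icc_infinite hab).mono fun c hc => ?_)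
  by_contra hne
  refine (intervalIntegral.integral_pos (f := fun x => p.eval x * p.eval x) hab (by fun_prop) (fun x _ => mul_self_nonneg _)
    ⟨c, hc, mul_self_pos.2 hne⟩).ne' h

lemma forall_Icc_eval_eq_zero_iff {ξ₀ ξ₁ : ℝ} (hξ : ξ₀ < ξ₁) {n : ℕ} {p : Polynomial ℝ}
    (hp : p.natDegree ≤ n) :
    (∀ ξ ∈ Set.Icc ξ₀ ξ₁, p.eval ξ = 0) ↔
      ∀ v : Polynomial ℝ, v.natDegree ≤ n → ∫ ξ in ξ₀..ξ₁, v.eval ξ * p.eval ξ = 0 := by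
  constructor
  · intro h v _
    rw [p.eq_zero_of_infinite_isRoot ((Set.Icc_infinite hξ).mono h)]
    simp
  · intro h ξ _
    rw [eq_zero_of_integral_eval_sq hξ (h p hp), Polynomial.eval_zero]

lemma etaCoeff_zero_pderiv (q : MvPolynomial (Fin 2) ℝ) :
    etaCoeff 0 (pderiv 0 q) = etaCoeff 1 q := by
  ext j
  simp [etaCoeff_coeff, coeff_pderiv, add_comm]

/-- The quantity whose weighted jump across `η = 0` is prescribed at order `k`:
the trace, the normal derivative, and then the normal derivatives of `𝓛 q`. -/
noncomputable def normalJet (J₀ J₁ J₂ : ℝ → ℝ → ℝ) :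
    ℕ → MvPolynomial (Fin 2) ℝ → ℝ → ℝ
  | 0, q, ξ => evalP q 0 ξ
  | 1, q, ξ => evalP (pderiv 0 q) 0 ξ
  | n + 2, q, ξ => iteratedDeriv n (fun t => Lop J₀ J₁ J₂ (evalP q) t ξ) 0

/-- The weight of the jet of order `k` on a side of the interface with coefficient `β`. -/
def jetWeight (β : ℝ) (k : ℕ) : ℝ := if k = 0 then 1 else β

section NormalJet

variable {J₀ J₁ J₂ : ℝ → ℝ → ℝ}
  (hJ₀ : ContDiff ℝ (⊤ : ℕ∞) (Function.uncurry J₀))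
  (hJ₁ : ContDiff ℝ (⊤ : ℕ∞) (Function.uncurry J₁))
  (hJ₂ : ContDiff ℝ (⊤ : ℕ∞) (Function.uncurry J₂))

lemma normalJet_smul (k : ℕ) (c : ℝ) (q : MvPolynomial (Fin 2) ℝ) (ξ : ℝ) :
    normalJet J₀ J₁ J₂ k (c • q) ξ = c * normalJet J₀ J₁ J₂ k q ξ := by
  match k with
  | 0 => simp [normalJet, evalP, smul_eval]
  | 1 => simp [normalJet, evalP, smul_eval]
  | n + 2 =>
    simp only [normalJet]
    rw [← iteratedDeriv_const_mul_field]
    congr 1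
    ext t
    simp only [Lop_evalP, evalP, Derivation.map_smul, smul_eval]
    ring

include hJ₀ hJ₁ hJ₂

lemma normalJet_add (k : ℕ) (p q : MvPolynomial (Fin 2) ℝ) (ξ : ℝ) :
    normalJet J₀ J₁ J₂ k (p + q) ξ = normalJet J₀ J₁ J₂ k p ξ + normalJet J₀ J₁ J₂ k q ξ := by
  match k with
  | 0 => simp [normalJet, evalP]
  | 1 => simp [normalJet, evalP]
  | n + 2 =>
    have hsmooth (q) : ContDiffAt ℝ n (fun t => Lop J₀ J₁ J₂ (evalP q) t ξ) 0 :=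
      ((contDiff_slice_left (contDiff_Lop_evalP hJ₀ hJ₁ hJ₂ q) ξ).of_le
        (by exact_mod_cast le_top)).contDiffAt
    simp only [normalJet]
    rw [← iteratedDeriv_fun_add (hsmooth p) (hsmooth q)]
    congr 1
    ext t
    simp only [Lop_evalP, evalP, map_add]
    ring

lemma continuous_normalJet (k : ℕ) (q : MvPolynomial (Fin 2) ℝ) :
    Continuous (normalJet J₀ J₁ J₂ k q) := by
  have hcont {F : ℝ → ℝ → ℝ} (hF : Continuous (Function.uncurry F)) : Continuous (F 0) :=
    hF.comp (continuous_const.prodMk continuous_id)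
  match k with
  | 0 => exact hcont (contDiff_evalP q (n := 0)).continuous
  | 1 => exact hcont (contDiff_evalP (pderiv 0 q) (n := 0)).continuous
  | n + 2 =>
    exact hcont (contDiff_iteratedDeriv_left (contDiff_Lop_evalP hJ₀ hJ₁ hJ₂ q) n).continuous

lemma normalJet_X_pow_mul (k : ℕ) (r : MvPolynomial (Fin 2) ℝ) (ξ : ℝ) :
    normalJet J₀ J₁ J₂ k (X 0 ^ k * r) ξ = k.factorial * evalP r 0 ξ := by
  match k with
  | 0 => simp [normalJet]
  | 1 => simp [normalJet, evalP]
  | n + 2 =>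
    have hslice (J : ℝ → ℝ → ℝ) (hJ : ContDiff ℝ (⊤ : ℕ∞) (Function.uncurry J)) :
        ContDiff ℝ n (fun t => J t ξ) :=
      (contDiff_slice_left hJ ξ).of_le (by exact_mod_cast le_top)
    have hpoly (q) : ContDiff ℝ n (fun t => evalP q t ξ) :=
      contDiff_slice_left (contDiff_evalP q) ξ
    have hfactor : (fun t => Lop J₀ J₁ J₂ (evalP (X 0 ^ (n + 2) * r)) t ξ) = fun t => t ^ n *
        ((n + 2) * (n + 1) * evalP r t ξ + 2 * (n + 2) * t * evalP (pderiv 0 r) t ξ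
          + t ^ 2 * evalP (pderiv 0 (pderiv 0 r)) t ξ
          + t ^ 2 * (J₀ t ξ * evalP (pderiv 1 (pderiv 1 r)) t ξ)
          + J₁ t ξ * ((n + 2) * t * evalP r t ξ + t ^ 2 * evalP (pderiv 0 r) t ξ)
          + t ^ 2 * (J₂ t ξ * evalP (pderiv 1 r) t ξ)) := by
      ext t
      have htwo : pderiv 0 (2 : MvPolynomial (Fin 2) ℝ) = 0 :=
        (pderiv 0).map_natCast 2
      simp [Lop_evalP, evalP, pderiv_X, htwo]
      ring
    have h₀ := hslice J₀ hJ₀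
    have h₁ := hslice J₁ hJ₁
    have h₂ := hslice J₂ hJ₂
    have h₃ := hpoly r
    have h₄ := hpoly (pderiv 0 r)
    have h₅ := hpoly (pderiv 0 (pderiv 0 r))
    have h₆ := hpoly (pderiv 1 (pderiv 1 r))
    have h₇ := hpoly (pderiv 1 r)
    simp only [normalJet, hfactor]
    rw [iteratedDeriv_pow_mul_zero (by fun_prop)]
    simp [Nat.factorial_succ]
    ring

/-- The pairing of the weighted jets of `q` with the coefficients of a test polynomial `w`. -/
noncomputable def jetPairing (m : ℕ) (ξ₀ ξ₁ : ℝ) (a : ℕ → ℝ) :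
    MvPolynomial (Fin 2) ℝ →ₗ[ℝ] MvPolynomial (Fin 2) ℝ →ₗ[ℝ] ℝ :=
  LinearMap.mk₂ ℝ
    (fun q w => ∑ k ∈ Finset.range (m + 1),
      a k * ∫ ξ in ξ₀..ξ₁, (etaCoeff k w).eval ξ * normalJet J₀ J₁ J₂ k q ξ)
    (fun p q w => by
      rw [← Finset.sum_add_distrib]
      refine Finset.sum_congr rfl fun k _ => ?_
      have hp := continuous_normalJet hJ₀ hJ₁ hJ₂ k p
      have hq := continuous_normalJet hJ₀ hJ₁ hJ₂ k q
      rw [← mul_add, ← intervalIntegral.integral_add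
        (Continuous.intervalIntegrable (by fun_prop) _ _)
        (Continuous.intervalIntegrable (by fun_prop) _ _)]
      simp only [normalJet_add hJ₀ hJ₁ hJ₂, mul_add])
    (fun c q w => by
      simp only [normalJet_smul, smul_eq_mul, Finset.mul_sum]
      refine Finset.sum_congr rfl fun k _ => ?_
      simp only [mul_left_comm _ c, intervalIntegral.integral_const_mul])
    (fun q v w => by
      rw [← Finset.sum_add_distrib]
      refine Finset.sum_congr rfl fun k _ => ?_
      have hq := continuous_normalJet hJ₀ hJ₁ hJ₂ k q
      rw [← mul_add, ← intervalIntegral.integral_add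
        (Continuous.intervalIntegrable (by fun_prop) _ _)
        (Continuous.intervalIntegrable (by fun_prop) _ _)]
      simp only [map_add, Polynomial.eval_add, add_mul])
    (fun c q w => by
      simp only [map_smul, Polynomial.eval_smul, smul_eq_mul, Finset.mul_sum]
      refine Finset.sum_congr rfl fun k _ => ?_
      simp only [mul_assoc c, mul_left_comm _ c, intervalIntegral.integral_const_mul])

lemma jetPairing_apply (m : ℕ) (ξ₀ ξ₁ : ℝ) (a : ℕ → ℝ) (q w : MvPolynomial (Fin 2) ℝ) :
    jetPairing hJ₀ hJ₁ hJ₂ m ξ₀ ξ₁ a q w = ∑ k ∈ Finset.range (m + 1),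
      a k * ∫ ξ in ξ₀..ξ₁, (etaCoeff k w).eval ξ * normalJet J₀ J₁ J₂ k q ξ := rfl

lemma jetPairing_symm_monomial {m k : ℕ} (hk : k ≤ m) (ξ₀ ξ₁ : ℝ) (a : ℕ → ℝ)
    (q : MvPolynomial (Fin 2) ℝ) (v : Polynomial ℝ) :
    jetPairing hJ₀ hJ₁ hJ₂ m ξ₀ ξ₁ a q (toPolyPoly.symm (Polynomial.monomial k v)) =
      a k * ∫ ξ in ξ₀..ξ₁, v.eval ξ * normalJet J₀ J₁ J₂ k q ξ := by
  rw [jetPairing_apply, Finset.sum_eq_single_of_mem k (Finset.mem_range.2 (by omega))]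
  · simp [etaCoeff_symm_monomial]
  · intro i _ hi
    simp [etaCoeff_symm_monomial, hi.symm]

lemma eq_zero_of_jetPairing {m : ℕ} {ξ₀ ξ₁ : ℝ} (hξ : ξ₀ < ξ₁) {a : ℕ → ℝ} (ha : ∀ k, a k ≠ 0)
    {q : MvPolynomial (Fin 2) ℝ} (hq : q.totalDegree ≤ m)
    (h : ∀ w : MvPolynomial (Fin 2) ℝ, w.totalDegree ≤ m →
      jetPairing hJ₀ hJ₁ hJ₂ m ξ₀ ξ₁ a q w = 0) : q = 0 := by
  have hdeg := totalDegree_le_iff_natDegree_etaCoeff.1 hq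
  refine eq_zero_of_etaCoeff fun k => ?_
  induction k using Nat.strong_induction_on with
  | h k ih =>
    rcases lt_or_ge m k with hk | hk
    · exact (hdeg k).2 hk
    obtain ⟨r, hr⟩ := X_pow_dvd_of_etaCoeff ih
    have hjet (ξ : ℝ) :
        normalJet J₀ J₁ J₂ k q ξ = k.factorial * (etaCoeff k q).eval ξ := by
      rw [hr, normalJet_X_pow_mul hJ₀ hJ₁ hJ₂, etaCoeff_X_pow_mul, evalP_zero_left]
    have hint := h _ (totalDegree_toPolyPoly_symm_monomial_le hk (hdeg k).1)
    rw [jetPairing_symm_monomial hJ₀ hJ₁ hJ₂ hk] at hint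
    simp only [hjet, mul_left_comm _ (k.factorial : ℝ),
      intervalIntegral.integral_const_mul] at hint
    refine eq_zero_of_integral_eval_sq hξ ?_
    simpa [ha k, k.factorial_ne_zero] using hint

lemma jetPairing_eq_iff {m : ℕ} {ξ₀ ξ₁ : ℝ} {a b : ℕ → ℝ} {p q : MvPolynomial (Fin 2) ℝ} :
    (∀ w : MvPolynomial (Fin 2) ℝ, w.totalDegree ≤ m →
      jetPairing hJ₀ hJ₁ hJ₂ m ξ₀ ξ₁ a p w = jetPairing hJ₀ hJ₁ hJ₂ m ξ₀ ξ₁ b q w) ↔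
    ∀ k ≤ m, ∀ v : Polynomial ℝ, v.natDegree ≤ m - k →
      ∫ ξ in ξ₀..ξ₁, v.eval ξ *
        (a k * normalJet J₀ J₁ J₂ k p ξ - b k * normalJet J₀ J₁ J₂ k q ξ) = 0 := by
  have hsplit (k : ℕ) (v : Polynomial ℝ) :
      ∫ ξ in ξ₀..ξ₁, v.eval ξ *
        (a k * normalJet J₀ J₁ J₂ k p ξ - b k * normalJet J₀ J₁ J₂ k q ξ) =
      a k * (∫ ξ in ξ₀..ξ₁, v.eval ξ * normalJet J₀ J₁ J₂ k p ξ) -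
        b k * ∫ ξ in ξ₀..ξ₁, v.eval ξ * normalJet J₀ J₁ J₂ k q ξ := by
    have hp := continuous_normalJet hJ₀ hJ₁ hJ₂ k p
    have hq := continuous_normalJet hJ₀ hJ₁ hJ₂ k q
    simp only [← intervalIntegral.integral_const_mul]
    rw [← intervalIntegral.integral_sub
      (Continuous.intervalIntegrable (by fun_prop) _ _)
      (Continuous.intervalIntegrable (by fun_prop) _ _)]
    congr 1
    ext ξ
    ring
  simp only [hsplit, sub_eq_zero]
  constructor
  · intro h k hk v hv
    simpa only [jetPairing_symm_monomial hJ₀ hJ₁ hJ₂ hk] using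
      h _ (totalDegree_toPolyPoly_symm_monomial_le hk hv)
  · intro h w hw
    simp only [jetPairing_apply]
    refine Finset.sum_congr rfl fun k hk => h k (Finset.mem_range_succ_iff.1 hk) _ ?_
    exact (totalDegree_le_iff_natDegree_etaCoeff.1 hw k).1

lemma jumpConds_iff_jetPairing {m : ℕ} (hm : 1 ≤ m) {ξ₀ ξ₁ : ℝ} (hξ : ξ₀ < ξ₁) (βm βp : ℝ)
    {qm qp : MvPolynomial (Fin 2) ℝ} (hqm : qm.totalDegree ≤ m) (hqp : qp.totalDegree ≤ m) :
    JumpConds m ξ₀ ξ₁ βm βp J₀ J₁ J₂ qm qp ↔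
      ∀ w : MvPolynomial (Fin 2) ℝ, w.totalDegree ≤ m →
        jetPairing hJ₀ hJ₁ hJ₂ m ξ₀ ξ₁ (jetWeight βp) qp w =
          jetPairing hJ₀ hJ₁ hJ₂ m ξ₀ ξ₁ (jetWeight βm) qm w := by
  have hdeg (k : ℕ) (a b : ℝ) : (a • etaCoeff k qp - b • etaCoeff k qm).natDegree ≤ m - k := by
    have hp := (totalDegree_le_iff_natDegree_etaCoeff.1 hqp k).1
    have hq := (totalDegree_le_iff_natDegree_etaCoeff.1 hqm k).1
    exact (Polynomial.natDegree_sub_le _ _).trans (max_le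
      ((Polynomial.natDegree_smul_le _ _).trans hp) ((Polynomial.natDegree_smul_le _ _).trans hq))
  have hzero := forall_Icc_eval_eq_zero_iff hξ (hdeg 0 1 1)
  have hone := forall_Icc_eval_eq_zero_iff hξ (hdeg 1 βp βm)
  have hderiv (q : MvPolynomial (Fin 2) ℝ) (ξ : ℝ) :
      deriv (fun t => evalP q t ξ) 0 = (etaCoeff 1 q).eval ξ := by
    rw [(hasDerivAt_evalP_left q 0 ξ).deriv, evalP_zero_left, etaCoeff_zero_pderiv]
  simp only [Polynomial.eval_sub, Polynomial.eval_smul, smul_eq_mul, one_mul] at hzero hone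
  rw [jetPairing_eq_iff hJ₀ hJ₁ hJ₂, JumpConds]
  simp only [hderiv, evalP_zero_left, ← sub_eq_zero (b := Polynomial.eval _ (etaCoeff 0 qm)),
    ← sub_eq_zero (b := βm * Polynomial.eval _ (etaCoeff 1 qm)), hzero, hone]
  constructor
  · rintro ⟨h0, h1, h2⟩ k hk
    match k with
    | 0 => simpa [jetWeight, normalJet, evalP_zero_left] using h0
    | 1 => simpa [jetWeight, normalJet, evalP_zero_left, etaCoeff_zero_pderiv] using h1
    | n + 2 =>
      simpa [jetWeight, normalJet, Nat.sub_sub, add_comm 2] using h2 n hk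
  · intro h
    refine ⟨?_, ?_, fun n hn => ?_⟩
    · simpa [jetWeight, normalJet, evalP_zero_left] using h 0 (Nat.zero_le m)
    · simpa [jetWeight, normalJet, evalP_zero_left, etaCoeff_zero_pderiv] using h 1 hm
    · simpa [jetWeight, normalJet, Nat.sub_sub, add_comm 2] using h (n + 2) hn

end NormalJet

/-- For every polynomial `q⁻` of total degree at most `m` there is a unique
polynomial `q⁺` of total degree at most `m` such that the pair `(q⁻, q⁺)`
satisfies the Frenet interface jump conditions. -/
theorem stmt_2 (m : ℕ) (hm : 1 ≤ m) (ξ₀ ξ₁ : ℝ) (hξ : ξ₀ < ξ₁)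
    (βm βp : ℝ) (hβm : 0 < βm) (hβp : 0 < βp)
    (J₀ J₁ J₂ : ℝ → ℝ → ℝ)
    (hJ₀ : ContDiff ℝ (⊤ : ℕ∞) (Function.uncurry J₀))
    (hJ₁ : ContDiff ℝ (⊤ : ℕ∞) (Function.uncurry J₁))
    (hJ₂ : ContDiff ℝ (⊤ : ℕ∞) (Function.uncurry J₂))
    (qm : MvPolynomial (Fin 2) ℝ) (hqm : qm.totalDegree ≤ m) :
    ∃! qp : MvPolynomial (Fin 2) ℝ,
      qp.totalDegree ≤ m ∧ JumpConds m ξ₀ ξ₁ βm βp J₀ J₁ J₂ qm qp := by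
  have weight_ne (k : ℕ) : jetWeight βp k ≠ 0 := by
    unfold jetWeight
    split_ifs
    exacts [one_ne_zero, hβp.ne']
  let W := restrictTotalDegree (Fin 2) ℝ m
  have mem_W {q : MvPolynomial (Fin 2) ℝ} : q ∈ W ↔ q.totalDegree ≤ m :=
    mem_restrictTotalDegree _ _ _
  let T : W →ₗ[ℝ] Module.Dual ℝ W :=
    (jetPairing hJ₀ hJ₁ hJ₂ m ξ₀ ξ₁ (jetWeight βp)).domRestrict₁₂ W W
  have T_injective : Function.Injective T := by
    refine (injective_iff_map_eq_zero T).2 fun q hq => Subtype.ext ?_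
    exact eq_zero_of_jetPairing hJ₀ hJ₁ hJ₂ hξ weight_ne (mem_W.1 q.2)
      fun w hw => LinearMap.congr_fun hq ⟨w, mem_W.2 hw⟩
  have T_surjective : Function.Surjective T :=
    (LinearMap.injective_iff_surjective_of_finrank_eq_finrank
      Subspace.dual_finrank_eq.symm).1 T_injective
  let F : Module.Dual ℝ W :=
    (jetPairing hJ₀ hJ₁ hJ₂ m ξ₀ ξ₁ (jetWeight βm) qm).domRestrict W
  have jump_iff (q : W) : JumpConds m ξ₀ ξ₁ βm βp J₀ J₁ J₂ qm q ↔ T q = F := by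
    rw [jumpConds_iff_jetPairing hJ₀ hJ₁ hJ₂ hm hξ βm βp hqm (mem_W.1 q.2)]
    exact ⟨fun h => LinearMap.ext fun w => h w (mem_W.1 w.2),
      fun h w hw => LinearMap.congr_fun h ⟨w, mem_W.2 hw⟩⟩
  obtain ⟨qp, hqp⟩ := T_surjective F
  refine ⟨qp, ⟨mem_W.1 qp.2, (jump_iff qp).2 hqp⟩, ?_⟩
  rintro q ⟨hq, hjump⟩
  exact congrArg Subtype.val
    (T_injective (((jump_iff ⟨q, mem_W.2 hq⟩).1 hjump).trans hqp.symm))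
end
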